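/- There do not exist positive integers n, d, ν1, ν2, a1, a2 and integers b1, b2 such that d ≥ 3, a1 ≠ b1, a2 ≠ b2, n divides ν1·(a1−b1) and n divides ν2·(a2−b2), ν1·a1 + ν2·a2 ≤ n, and d·(ν1·b1^2 + ν2·b2^2) ≤ n. -/

import Mathlib

/-- The arithmetic core of the irreducibility proof: there are no positive integers
`n, d, ν1, ν2, a1, a2` and integers `b1, b2` with `d ≥ 3`, `a1 ≠ b1`, `a2 ≠ b2`,
`n ∣ νi(ai − bi)`, `ν1·a1 + ν2·a2 ≤ n` and `d(ν1·b1² + ν2·b2²) ≤ n`. -/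
theorem stmt_19 :
    ¬ ∃ (n d ν1 ν2 a1 a2 b1 b2 : ℤ),
      0 < n ∧ 0 < d ∧ 0 < ν1 ∧ 0 < ν2 ∧ 0 < a1 ∧ 0 < a2 ∧ 3 ≤ d ∧
      a1 ≠ b1 ∧ a2 ≠ b2 ∧
      n ∣ ν1 * (a1 - b1) ∧ n ∣ ν2 * (a2 - b2) ∧
      ν1 * a1 + ν2 * a2 ≤ n ∧ d * (ν1 * b1 ^ 2 + ν2 * b2 ^ 2) ≤ n := by
  rintro ⟨n, d, v, w, a, a', b, b', hn, hd, hv, hw, ha, ha', hd3, hab, hab', h1, h2, h3, h4⟩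
  have key : ∀ v a b : ℤ, 0 < v → 0 < a → a ≠ b → n ∣ v * (a - b) →
      n ≤ v * a + v * b ^ 2 := by
    intro v a b hv ha hab h
    have h5 : n ≤ |v * (a - b)| :=
      Int.le_of_dvd (abs_pos.mpr (mul_ne_zero hv.ne' (sub_ne_zero.mpr hab))) ((dvd_abs _ _).mpr h)
    have h6 : |a - b| ≤ a + b ^ 2 := by
      have e1 : b ≤ b ^ 2 := Int.le_self_sq b
      have e2 : -b ≤ b ^ 2 := by
        have := Int.le_self_sq (-b)
        rwa [neg_sq] at this
      rw [abs_le]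
      constructor <;> linarith
    rw [abs_mul, abs_of_pos hv] at h5
    have h7 := mul_le_mul_of_nonneg_left h6 hv.le
    linarith
  have k1 := key v a b hv ha hab h1
  have k2 := key w a' b' hw ha' hab' h2
  have h8 : 0 ≤ v * b ^ 2 + w * b' ^ 2 := by positivity
  have h9 := mul_le_mul_of_nonneg_right hd3 h8
  linarith
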